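/- arXiv:1307.4420 — 5 statements merged into one kernel-verified Lean document; each statement's English description precedes it below -/
import Mathlib

section
/- Let G = (V, E) be a cubic simple graph, let H = f(G), let M be a control matching of H containing no pair of mutually reverse arcs, and let u ∈ V. Then the number of weight-1 arcs associated with u that lie in M is at most 3; moreover, if not all three u-associate edge-arcs lie in M, then the number of weight-1 arcs associated with u that lie in M is at most 2. -/
/-! Construction `H = f(G)` from the APX-hardness reduction.  `G` is a cubic simple
graph on `V` with a fixed ordering `nbr u 0, nbr u 1, nbr u 2` of the neighbors of each
vertex `u`.  The vertices of `H` are the tokens `t_{uv}`, encoded as ordered pairs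
`(u, v) : V × V` (only pairs with `G.Adj u v` occur in arcs).  An arc of `H` is an
ordered pair of such tokens. -/

/-- An arc of `H`: an ordered pair of tokens `t_{uv}`. -/
abbrev Arc (V : Type*) := (V × V) × (V × V)

/-- The edge-arc `(t_{uv}, t_{vu})` associated with `u`, for the edge `{u, v}`. -/
def edgeArc {V : Type*} (u v : V) : Arc V := ((u, v), (v, u))

/-- The first node-arc `(t_{u v1}, t_{v2 u})` associated with `u`. -/
def nodeArc1 {V : Type*} (nbr : V → Fin 3 → V) (u : V) : Arc V :=
  ((u, nbr u 0), (nbr u 1, u))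

/-- The second node-arc `(t_{u v2}, t_{v3 u})` associated with `u`. -/
def nodeArc2 {V : Type*} (nbr : V → Fin 3 → V) (u : V) : Arc V :=
  ((u, nbr u 1), (nbr u 2, u))

/-- `a` is an edge-arc of `H`, i.e. `a = (t_{uv}, t_{vu})` for some edge `{u, v}` of `G`. -/
def IsEdgeArc {V : Type*} (G : SimpleGraph V) (a : Arc V) : Prop :=
  G.Adj a.1.1 a.1.2 ∧ a.2 = (a.1.2, a.1.1)

/-- `a` is a node-arc of `H`. -/
def IsNodeArc {V : Type*} (nbr : V → Fin 3 → V) (a : Arc V) : Prop :=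
  ∃ u, a = nodeArc1 nbr u ∨ a = nodeArc2 nbr u

/-- `a` is an arc of `H = f(G)`: an edge-arc (weight 1), a node-arc (weight 1), or the
reverse of a node-arc (weight 0). -/
def IsArcH {V : Type*} (G : SimpleGraph V) (nbr : V → Fin 3 → V) (a : Arc V) : Prop :=
  IsEdgeArc G a ∨ IsNodeArc nbr a ∨ IsNodeArc nbr (Prod.swap a)

/-- A control matching of `H`: a set of arcs of `H` such that each vertex of `H` is the
head of at most one arc in `M` and the tail of at most one arc in `M`. -/
def IsControlMatching {V : Type*} (G : SimpleGraph V) (nbr : V → Fin 3 → V)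
    (M : Finset (Arc V)) : Prop :=
  (∀ a ∈ M, IsArcH G nbr a) ∧
  (∀ a ∈ M, ∀ b ∈ M, a.1 = b.1 → a = b) ∧
  (∀ a ∈ M, ∀ b ∈ M, a.2 = b.2 → a = b)

/-- `M` contains no pair of mutually reverse arcs. -/
def NoReversePair {V : Type*} (M : Finset (Arc V)) : Prop :=
  ∀ a ∈ M, Prod.swap a ∉ M

open scoped Classical in
/-- The weight of `M`: edge-arcs and node-arcs have weight 1, all other arcs (the
reverses of node-arcs) have weight 0, so `w(M)` is the number of edge- and node-arcs
in `M`. -/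
noncomputable def weightM {V : Type*} (G : SimpleGraph V) (nbr : V → Fin 3 → V)
    (M : Finset (Arc V)) : ℕ :=
  (M.filter (fun a => IsEdgeArc G a ∨ IsNodeArc nbr a)).card

open scoped Classical in
/-- `V₃(M)`: the set of vertices `u` of `G` all three of whose associated edge-arcs lie
in `M`. -/
noncomputable def V3 {V : Type*} [Fintype V] (nbr : V → Fin 3 → V)
    (M : Finset (Arc V)) : Finset V :=
  Finset.univ.filter (fun u => ∀ i : Fin 3, edgeArc u (nbr u i) ∈ M)

/-- The five weight-1 arcs associated with the vertex `u`: its three edge-arcs and its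
two node-arcs. -/
def assocArcs {V : Type*} [DecidableEq V] (nbr : V → Fin 3 → V) (u : V) :
    Finset (Arc V) :=
  {edgeArc u (nbr u 0), edgeArc u (nbr u 1), edgeArc u (nbr u 2),
   nodeArc1 nbr u, nodeArc2 nbr u}

/-- The independence number `α(G)`. -/
noncomputable def indepNum {V : Type*} [Fintype V] (G : SimpleGraph V) : ℕ :=
  sSup {k : ℕ | ∃ S : Finset V, (∀ a ∈ S, ∀ b ∈ S, ¬ G.Adj a b) ∧ S.card = k}

/-- `OPT(H)`: the maximum weight of a control matching of `H` containing no pair of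
mutually reverse arcs. -/
noncomputable def OPT {V : Type*} (G : SimpleGraph V) (nbr : V → Fin 3 → V) : ℕ :=
  sSup {k : ℕ | ∃ M : Finset (Arc V),
    IsControlMatching G nbr M ∧ NoReversePair M ∧ weightM G nbr M = k}

/-- In a control matching, consecutive arcs of the sequence `edgeArc u v1`, `nodeArc1 u`,
`edgeArc u v2`, `nodeArc2 u`, `edgeArc u v3` exclude each other. -/
lemma IsControlMatching.assocArcs_conflicts {V : Type*} {G : SimpleGraph V}
    {nbr : V → Fin 3 → V} {M : Finset (Arc V)} (hM : IsControlMatching G nbr M) {u : V}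
    (hinj : Function.Injective (nbr u)) :
    ¬ (edgeArc u (nbr u 0) ∈ M ∧ nodeArc1 nbr u ∈ M) ∧
      ¬ (edgeArc u (nbr u 1) ∈ M ∧ nodeArc1 nbr u ∈ M) ∧
      ¬ (edgeArc u (nbr u 1) ∈ M ∧ nodeArc2 nbr u ∈ M) ∧
      ¬ (edgeArc u (nbr u 2) ∈ M ∧ nodeArc2 nbr u ∈ M) := by
  obtain ⟨-, htail, hhead⟩ := hM
  refine ⟨fun ⟨h, h'⟩ => ?_, fun ⟨h, h'⟩ => ?_, fun ⟨h, h'⟩ => ?_, fun ⟨h, h'⟩ => ?_⟩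
  · simpa [edgeArc, nodeArc1, hinj.eq_iff] using htail _ h _ h' rfl
  · simpa [edgeArc, nodeArc1, hinj.eq_iff] using hhead _ h _ h' rfl
  · simpa [edgeArc, nodeArc2, hinj.eq_iff] using htail _ h _ h' rfl
  · simpa [edgeArc, nodeArc2, hinj.eq_iff] using hhead _ h _ h' rfl

/-- The number of weight-1 arcs associated with `u` lying in `M` is at most 3; if not all
three `u`-associate edge-arcs lie in `M`, it is at most 2. -/
theorem stmt10 {V : Type*} [Fintype V] [DecidableEq V] (G : SimpleGraph V)
    (nbr : V → Fin 3 → V)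
    (hadj : ∀ u v : V, G.Adj u v ↔ ∃ i : Fin 3, nbr u i = v)
    (hinj : ∀ u : V, Function.Injective (nbr u))
    (M : Finset (Arc V)) (hM : IsControlMatching G nbr M) (hrev : NoReversePair M)
    (u : V) :
    ((assocArcs nbr u).filter (fun a => a ∈ M)).card ≤ 3 ∧
      ((¬ ∀ i : Fin 3, edgeArc u (nbr u i) ∈ M) →
        ((assocArcs nbr u).filter (fun a => a ∈ M)).card ≤ 2) := by
  obtain ⟨h₁, h₂, h₃, h₄⟩ := hM.assocArcs_conflicts (hinj u)
  rw [assocArcs, Fin.forall_fin_succ, Fin.forall_fin_two]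
  by_cases e₀ : edgeArc u (nbr u 0) ∈ M <;> by_cases e₁ : edgeArc u (nbr u 1) ∈ M <;>
    by_cases e₂ : edgeArc u (nbr u 2) ∈ M <;> by_cases n₁ : nodeArc1 nbr u ∈ M <;>
    by_cases n₂ : nodeArc2 nbr u ∈ M <;>
    simp_all [Finset.filter_insert, Finset.filter_singleton,
      Finset.card_le_three, Finset.card_le_two.trans]
end

section
/- Let G = (V, E) be a cubic simple graph with n = |V|, let H = f(G), and let M be any control matching of H containing no pair of mutually reverse arcs. Then the weight of M satisfies w(M) ≤ 2n + |V_3(M)|, where V_3(M) is the set of vertices u ∈ V all three of whose associated edge-arcs lie in M. -/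
/-- Consecutive arcs of the path `e₀, N₁, e₁, N₂, e₂` of arcs associated with `u` share a head or a
tail, so they cannot both lie in a control matching. -/
theorem IsControlMatching.not_mem_of_mem {V : Type*} {G : SimpleGraph V} {nbr : V → Fin 3 → V}
    {M : Finset (Arc V)} (hM : IsControlMatching G nbr M) {u : V}
    (hu : Function.Injective (nbr u)) :
    (nodeArc1 nbr u ∈ M → edgeArc u (nbr u 0) ∉ M ∧ edgeArc u (nbr u 1) ∉ M) ∧
    (nodeArc2 nbr u ∈ M → edgeArc u (nbr u 1) ∉ M ∧ edgeArc u (nbr u 2) ∉ M) := by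
  obtain ⟨-, htail, hhead⟩ := hM
  have h01 : nbr u 0 ≠ nbr u 1 := hu.ne (by decide)
  have h12 : nbr u 1 ≠ nbr u 2 := hu.ne (by decide)
  refine ⟨fun h => ⟨fun h' => ?_, fun h' => ?_⟩, fun h => ⟨fun h' => ?_, fun h' => ?_⟩⟩
  · exact h01 (Prod.ext_iff.1 (Prod.ext_iff.1 (htail _ h _ h' rfl)).2).1.symm
  · exact h01 (Prod.ext_iff.1 (Prod.ext_iff.1 (hhead _ h _ h' rfl)).1).2
  · exact h12 (Prod.ext_iff.1 (Prod.ext_iff.1 (htail _ h _ h' rfl)).2).1.symm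
  · exact h12 (Prod.ext_iff.1 (Prod.ext_iff.1 (hhead _ h _ h' rfl)).1).2

/-- An arc of weight 1 is associated with the first component of its first token. -/
theorem mem_assocArcs_of_weight_one {V : Type*} [DecidableEq V] {G : SimpleGraph V}
    {nbr : V → Fin 3 → V} (hadj : ∀ u v : V, G.Adj u v ↔ ∃ i : Fin 3, nbr u i = v)
    {a : Arc V} (ha : IsEdgeArc G a ∨ IsNodeArc nbr a) : a ∈ assocArcs nbr a.1.1 := by
  rcases ha with ⟨h, h2⟩ | ⟨u, rfl | rfl⟩
  · obtain ⟨⟨u, v⟩, b⟩ := a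
    obtain ⟨i, rfl⟩ : ∃ i, nbr u i = v := (hadj _ _).1 h
    obtain rfl : b = (nbr u i, u) := h2
    fin_cases i <;> simp [assocArcs, edgeArc]
  · simp [assocArcs, nodeArc1]
  · simp [assocArcs, nodeArc2]

/-- A control matching contains at most two of the arcs associated with `u`, or three if these
include all the edge-arcs of `u`. -/
theorem IsControlMatching.card_filter_assocArcs_le {V : Type*} [Fintype V] [DecidableEq V]
    {G : SimpleGraph V} {nbr : V → Fin 3 → V} {M : Finset (Arc V)}
    (hM : IsControlMatching G nbr M) {u : V} (hu : Function.Injective (nbr u)) :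
    ((assocArcs nbr u).filter (· ∈ M)).card ≤ 2 + if u ∈ V3 nbr M then 1 else 0 := by
  obtain ⟨h1, h2⟩ := hM.not_mem_of_mem hu
  have hV3 : u ∈ V3 nbr M ↔ edgeArc u (nbr u 0) ∈ M ∧ edgeArc u (nbr u 1) ∈ M ∧
      edgeArc u (nbr u 2) ∈ M := by
    simp [V3, Fin.forall_fin_succ]
  simp only [hV3, assocArcs, Finset.filter_insert, Finset.filter_singleton]
  by_cases m0 : edgeArc u (nbr u 0) ∈ M <;> by_cases m1 : edgeArc u (nbr u 1) ∈ M <;>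
    by_cases m2 : edgeArc u (nbr u 2) ∈ M <;> by_cases n1 : nodeArc1 nbr u ∈ M <;>
    by_cases n2 : nodeArc2 nbr u ∈ M <;>
    simp_all [Finset.card_le_two, Finset.card_le_three]

/-- For any control matching `M` of `H = f(G)` with no pair of mutually reverse arcs,
`w(M) ≤ 2n + |V₃(M)|`. -/
theorem stmt11 {V : Type*} [Fintype V] [DecidableEq V] (G : SimpleGraph V)
    (nbr : V → Fin 3 → V)
    (hadj : ∀ u v : V, G.Adj u v ↔ ∃ i : Fin 3, nbr u i = v)
    (hinj : ∀ u : V, Function.Injective (nbr u))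
    (M : Finset (Arc V)) (hM : IsControlMatching G nbr M) (hrev : NoReversePair M) :
    weightM G nbr M ≤ 2 * Fintype.card V + (V3 nbr M).card := by
  classical
  unfold weightM
  rw [Finset.card_eq_sum_card_fiberwise (f := fun a : Arc V => a.1.1) (t := Finset.univ)
    (fun _ _ => Finset.mem_coe.2 (Finset.mem_univ _))]
  calc _ ≤ ∑ u : V, (2 + if u ∈ V3 nbr M then 1 else 0) := by
        refine Finset.sum_le_sum fun u _ =>
          (Finset.card_le_card fun a ha => ?_).trans (hM.card_filter_assocArcs_le (hinj u))
        simp only [Finset.mem_filter] at ha ⊢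
        obtain ⟨⟨haM, ha⟩, rfl⟩ := ha
        exact ⟨mem_assocArcs_of_weight_one hadj ha, haM⟩
    _ = 2 * Fintype.card V + (V3 nbr M).card := by
        simp [Finset.sum_add_distrib, mul_comm]
end

section
/- Let G = (V, E) be a cubic simple graph with n = |V| and let H = f(G). Then for every independent set S of G, there exists a control matching M of H containing no pair of mutually reverse arcs such that V_3(M) ⊇ S and w(M) ≥ 2n + |S|. -/
/-- The control matching built from a vertex set `S`: the three edge-arcs of every vertex in
`S`, and the two node-arcs of every other vertex. -/
def matchingOf {V : Type*} [Fintype V] [DecidableEq V] (nbr : V → Fin 3 → V) (S : Finset V) :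
    Finset (Arc V) :=
  (S ×ˢ Finset.univ).image (fun p : V × Fin 3 => edgeArc p.1 (nbr p.1 p.2)) ∪
    (Sᶜ.image (nodeArc1 nbr) ∪ Sᶜ.image (nodeArc2 nbr))

lemma mem_matchingOf {V : Type*} [Fintype V] [DecidableEq V] {nbr : V → Fin 3 → V}
    {S : Finset V} {a : Arc V} :
    a ∈ matchingOf nbr S ↔ (∃ u ∈ S, ∃ i, a = edgeArc u (nbr u i)) ∨
      ∃ u ∉ S, a = nodeArc1 nbr u ∨ a = nodeArc2 nbr u := by
  simp only [matchingOf, Finset.mem_union, Finset.mem_image, Finset.mem_product,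
    Finset.mem_univ, Finset.mem_compl, and_true, Prod.exists]
  grind

lemma card_matchingOf {V : Type*} [Fintype V] [DecidableEq V] {nbr : V → Fin 3 → V}
    (hinj : ∀ u : V, Function.Injective (nbr u)) (S : Finset V) :
    (matchingOf nbr S).card = 2 * Fintype.card V + S.card := by
  have h01 (u : V) : nbr u 0 ≠ nbr u 1 := (hinj u).ne (by decide)
  have h12 (u : V) : nbr u 1 ≠ nbr u 2 := (hinj u).ne (by decide)
  rw [matchingOf, Finset.card_union_of_disjoint, Finset.card_union_of_disjoint,
    Finset.card_image_of_injective, Finset.card_image_of_injective,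
    Finset.card_image_of_injective, Finset.card_product, Finset.card_compl,
    Finset.card_univ, Fintype.card_fin]
  · have := S.card_le_univ
    omega
  · intro u v h
    exact congrArg (fun a : Arc V => a.1.1) h
  · intro u v h
    exact congrArg (fun a : Arc V => a.1.1) h
  · rintro ⟨u, i⟩ ⟨v, j⟩ h
    simp only [edgeArc, Prod.mk.injEq] at h
    obtain ⟨⟨rfl, h⟩, -⟩ := h
    rw [hinj u h]
  · simp only [Finset.disjoint_left, Finset.mem_image, nodeArc1, nodeArc2]
    grind
  · simp only [Finset.disjoint_left, Finset.mem_union, Finset.mem_image, nodeArc1, nodeArc2,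
      edgeArc]
    grind

/-- For every independent set `S` of `G`, there is a control matching `M` of `H = f(G)`
with no pair of mutually reverse arcs such that `V₃(M) ⊇ S` and `w(M) ≥ 2n + |S|`. -/
theorem stmt12 {V : Type*} [Fintype V] [DecidableEq V] (G : SimpleGraph V)
    (nbr : V → Fin 3 → V)
    (hadj : ∀ u v : V, G.Adj u v ↔ ∃ i : Fin 3, nbr u i = v)
    (hinj : ∀ u : V, Function.Injective (nbr u))
    (S : Finset V) (hS : ∀ a ∈ S, ∀ b ∈ S, ¬ G.Adj a b) :
    ∃ M : Finset (Arc V), IsControlMatching G nbr M ∧ NoReversePair M ∧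
      S ⊆ V3 nbr M ∧ 2 * Fintype.card V + S.card ≤ weightM G nbr M := by
  have h01 (u : V) : nbr u 0 ≠ nbr u 1 := (hinj u).ne (by decide)
  have h12 (u : V) : nbr u 1 ≠ nbr u 2 := (hinj u).ne (by decide)
  have hnbr (u : V) (i : Fin 3) : G.Adj u (nbr u i) := (hadj u _).2 ⟨i, rfl⟩
  refine ⟨matchingOf nbr S, ⟨fun a ha => ?_, fun a ha b hb hab => ?_, fun a ha b hb hab => ?_⟩,
    fun a ha hs => ?_, fun u hu => ?_, ?_⟩
  · rcases mem_matchingOf.1 ha with ⟨u, -, i, rfl⟩ | ⟨u, -, h⟩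
    · exact Or.inl ⟨hnbr u i, rfl⟩
    · exact Or.inr (Or.inl ⟨u, h⟩)
  · rw [mem_matchingOf] at ha hb
    simp only [edgeArc, nodeArc1, nodeArc2] at ha hb
    grind
  · rw [mem_matchingOf] at ha hb
    simp only [edgeArc, nodeArc1, nodeArc2] at ha hb
    grind
  · rw [mem_matchingOf] at ha hs
    simp only [edgeArc, nodeArc1, nodeArc2] at ha hs
    rcases ha with ⟨u, hu, i, rfl⟩ | ⟨u, hu, rfl | rfl⟩ <;>
      rcases hs with ⟨v, hv, j, h⟩ | ⟨v, hv, h | h⟩ <;>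
      simp only [Prod.swap_prod_mk, Prod.mk.injEq] at h <;> grind
  · simp only [V3, Finset.mem_filter, Finset.mem_univ, true_and]
    exact fun i => mem_matchingOf.2 (Or.inl ⟨u, hu, i, rfl⟩)
  · classical
    rw [← card_matchingOf hinj S]
    refine Finset.card_le_card fun a ha => Finset.mem_filter.2 ⟨ha, ?_⟩
    rcases mem_matchingOf.1 ha with ⟨u, -, i, rfl⟩ | ⟨u, -, h⟩
    · exact Or.inl ⟨hnbr u i, rfl⟩
    · exact Or.inr ⟨u, h⟩
end

section
/- Let G = (V, E) be a cubic simple graph with n = |V| and let H = f(G). Then OPT(H), the maximum weight of a control matching of H containing no pair of mutually reverse arcs, equals 2n + α(G), where α(G) is the independence number of G. -/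
/-- The arcs chosen at `u` in the control matching built from an independent set `S`: the three
edge-arcs if `u ∈ S`, and the two node-arcs otherwise. -/
def indepArcs {V : Type*} [DecidableEq V] (nbr : V → Fin 3 → V) (S : Finset V) (u : V) :
    Finset (Arc V) :=
  if u ∈ S then Finset.univ.image (fun i => edgeArc u (nbr u i))
  else {nodeArc1 nbr u, nodeArc2 nbr u}

theorem mem_indepArcs {V : Type*} [DecidableEq V] {nbr : V → Fin 3 → V} {S : Finset V} {u : V}
    {a : Arc V} : a ∈ indepArcs nbr S u ↔
      (u ∈ S ∧ ∃ i, a = edgeArc u (nbr u i)) ∨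
      (u ∉ S ∧ (a = nodeArc1 nbr u ∨ a = nodeArc2 nbr u)) := by
  unfold indepArcs
  split_ifs with h <;> simp [h, eq_comm]

theorem fst_fst_of_mem_indepArcs {V : Type*} [DecidableEq V] {nbr : V → Fin 3 → V} {S : Finset V}
    {u : V} {a : Arc V} (h : a ∈ indepArcs nbr S u) : a.1.1 = u := by
  rcases mem_indepArcs.1 h with ⟨_, i, rfl⟩ | ⟨_, rfl | rfl⟩ <;> rfl

theorem snd_snd_of_mem_indepArcs {V : Type*} [DecidableEq V] {nbr : V → Fin 3 → V} {S : Finset V}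
    {u : V} {a : Arc V} (h : a ∈ indepArcs nbr S u) : a.2.2 = u := by
  rcases mem_indepArcs.1 h with ⟨_, i, rfl⟩ | ⟨_, rfl | rfl⟩ <;> rfl

theorem card_indepArcs {V : Type*} [DecidableEq V] {nbr : V → Fin 3 → V}
    (hinj : ∀ u : V, Function.Injective (nbr u)) (S : Finset V) (u : V) :
    (indepArcs nbr S u).card = 2 + if u ∈ S then 1 else 0 := by
  unfold indepArcs
  split_ifs with h
  · rw [Finset.card_image_of_injective]
    · simp
    · intro i j hij
      simp only [edgeArc, Prod.mk.injEq] at hij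
      exact hinj u hij.1.2
  · rw [Finset.card_pair]
    simp [nodeArc1, nodeArc2, (hinj u).eq_iff]

/-- An independent set `S` gives a control matching without reverse pairs of weight
`2n + |S|`. -/
theorem exists_controlMatching_of_indep {V : Type*} [Fintype V] [DecidableEq V]
    (G : SimpleGraph V) (nbr : V → Fin 3 → V)
    (hadj : ∀ u v : V, G.Adj u v ↔ ∃ i : Fin 3, nbr u i = v)
    (hinj : ∀ u : V, Function.Injective (nbr u))
    (S : Finset V) (hS : ∀ a ∈ S, ∀ b ∈ S, ¬ G.Adj a b) :
    ∃ M : Finset (Arc V), IsControlMatching G nbr M ∧ NoReversePair M ∧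
      weightM G nbr M = 2 * Fintype.card V + S.card := by
  have hw : ∀ u, ∀ a ∈ indepArcs nbr S u, IsEdgeArc G a ∨ IsNodeArc nbr a := by
    intro u a ha
    rcases mem_indepArcs.1 ha with ⟨_, i, rfl⟩ | ⟨_, h⟩
    · exact Or.inl ⟨(hadj _ _).2 ⟨i, rfl⟩, rfl⟩
    · exact Or.inr ⟨u, h⟩
  have h01 : ∀ u, nbr u 0 ≠ nbr u 1 := fun u h => by simpa using hinj u h
  have h12 : ∀ u, nbr u 1 ≠ nbr u 2 := fun u h => by simpa using hinj u h
  refine ⟨Finset.univ.biUnion (indepArcs nbr S), ⟨?_, ?_, ?_⟩, ?_, ?_⟩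
  · intro a ha
    obtain ⟨u, -, hu⟩ := Finset.mem_biUnion.1 ha
    rcases hw u a hu with h | h
    · exact Or.inl h
    · exact Or.inr (Or.inl h)
  · intro a ha b hb hab
    obtain ⟨u, -, hu⟩ := Finset.mem_biUnion.1 ha
    obtain ⟨v, -, hv⟩ := Finset.mem_biUnion.1 hb
    obtain rfl : u = v := by
      rw [← fst_fst_of_mem_indepArcs hu, ← fst_fst_of_mem_indepArcs hv, hab]
    rcases mem_indepArcs.1 hu with ⟨h1, i, rfl⟩ | ⟨h1, rfl | rfl⟩ <;>
    rcases mem_indepArcs.1 hv with ⟨h2, j, rfl⟩ | ⟨h2, rfl | rfl⟩ <;>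
    simp_all [edgeArc, nodeArc1, nodeArc2, (hinj u).eq_iff]
  · intro a ha b hb hab
    obtain ⟨u, -, hu⟩ := Finset.mem_biUnion.1 ha
    obtain ⟨v, -, hv⟩ := Finset.mem_biUnion.1 hb
    obtain rfl : u = v := by
      rw [← snd_snd_of_mem_indepArcs hu, ← snd_snd_of_mem_indepArcs hv, hab]
    rcases mem_indepArcs.1 hu with ⟨h1, i, rfl⟩ | ⟨h1, rfl | rfl⟩ <;>
    rcases mem_indepArcs.1 hv with ⟨h2, j, rfl⟩ | ⟨h2, rfl | rfl⟩ <;>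
    simp_all [edgeArc, nodeArc1, nodeArc2, (hinj u).eq_iff]
  · intro a ha hb
    obtain ⟨u, -, hu⟩ := Finset.mem_biUnion.1 ha
    obtain ⟨v, -, hv⟩ := Finset.mem_biUnion.1 hb
    have h1 : a.2.1 = v := fst_fst_of_mem_indepArcs hv
    have h2 : a.1.2 = v := snd_snd_of_mem_indepArcs hv
    rcases mem_indepArcs.1 hu with ⟨huS, i, rfl⟩ | ⟨_, rfl | rfl⟩
    · rcases mem_indepArcs.1 hv with ⟨hvS, -⟩ | ⟨_, h | h⟩
      · exact hS u huS v hvS ((hadj _ _).2 ⟨i, h1⟩)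
      · simp only [edgeArc, nodeArc1, Prod.swap, Prod.mk.injEq] at h
        exact h01 v (h.1.2.symm.trans h.2.1)
      · simp only [edgeArc, nodeArc2, Prod.swap, Prod.mk.injEq] at h
        exact h12 v (h.1.2.symm.trans h.2.1)
    · exact h01 u (h2.trans h1.symm)
    · exact h12 u (h2.trans h1.symm)
  · classical
    unfold weightM
    rw [Finset.filter_eq_self.2, Finset.card_biUnion]
    · simp [card_indepArcs hinj, Finset.sum_add_distrib, mul_comm]
    · intro u _ v _ huv
      refine Finset.disjoint_left.2 ?_
      intro a ha hb
      exact huv ((fst_fst_of_mem_indepArcs ha).symm.trans (fst_fst_of_mem_indepArcs hb))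
    · intro a ha
      obtain ⟨u, -, hu⟩ := Finset.mem_biUnion.1 ha
      exact hw u a hu

/-- Every arc of weight 1 with tail `t_{uv}` is associated with `u`. -/
theorem mem_assocArcs {V : Type*} [DecidableEq V] (G : SimpleGraph V) (nbr : V → Fin 3 → V)
    (hadj : ∀ u v : V, G.Adj u v ↔ ∃ i : Fin 3, nbr u i = v) {a : Arc V}
    (ha : IsEdgeArc G a ∨ IsNodeArc nbr a) : a ∈ assocArcs nbr a.1.1 := by
  rcases ha with ⟨h, h'⟩ | ⟨u, rfl | rfl⟩
  · obtain ⟨⟨u, v⟩, b⟩ := a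
    obtain ⟨i, hi⟩ := (hadj _ _).1 h
    simp only at h' hi
    subst h' hi
    fin_cases i <;> simp [assocArcs, edgeArc]
  · simp [assocArcs, nodeArc1]
  · simp [assocArcs, nodeArc2]

/-- A control matching contains at most two weight-1 arcs associated with a vertex, or three
when it contains all three edge-arcs of that vertex. -/
theorem card_assocArcs_filter_le {V : Type*} [Fintype V] [DecidableEq V] (G : SimpleGraph V)
    (nbr : V → Fin 3 → V) (hinj : ∀ u : V, Function.Injective (nbr u)) (M : Finset (Arc V))
    (hM : IsControlMatching G nbr M) (u : V) :
    ((assocArcs nbr u).filter (· ∈ M)).card ≤ 2 + if u ∈ V3 nbr M then 1 else 0 := by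
  obtain ⟨-, ht, hh⟩ := hM
  have h01 : nbr u 0 ≠ nbr u 1 := fun h => by simpa using hinj u h
  have h12 : nbr u 1 ≠ nbr u 2 := fun h => by simpa using hinj u h
  have c1 : edgeArc u (nbr u 0) ∈ M → nodeArc1 nbr u ∉ M := fun h h' => by
    have := ht _ h _ h' rfl
    simp [edgeArc, nodeArc1, h01] at this
  have c2 : edgeArc u (nbr u 1) ∈ M → nodeArc1 nbr u ∉ M := fun h h' => by
    have := hh _ h _ h' rfl
    simp [edgeArc, nodeArc1, h01.symm] at this
  have c3 : edgeArc u (nbr u 1) ∈ M → nodeArc2 nbr u ∉ M := fun h h' => by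
    have := ht _ h _ h' rfl
    simp [edgeArc, nodeArc2, h12] at this
  have c4 : edgeArc u (nbr u 2) ∈ M → nodeArc2 nbr u ∉ M := fun h h' => by
    have := hh _ h _ h' rfl
    simp [edgeArc, nodeArc2, h12.symm] at this
  have hV : u ∈ V3 nbr M ↔ edgeArc u (nbr u 0) ∈ M ∧ edgeArc u (nbr u 1) ∈ M ∧
      edgeArc u (nbr u 2) ∈ M := by
    simp [V3, Fin.forall_fin_succ]
  simp only [assocArcs, Finset.filter_insert, Finset.filter_singleton, hV]
  by_cases e0 : edgeArc u (nbr u 0) ∈ M <;> by_cases e1 : edgeArc u (nbr u 1) ∈ M <;>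
  by_cases e2 : edgeArc u (nbr u 2) ∈ M <;> by_cases n1 : nodeArc1 nbr u ∈ M <;>
  by_cases n2 : nodeArc2 nbr u ∈ M <;>
  first
  | exact absurd n1 (c1 e0)
  | exact absurd n1 (c2 e1)
  | exact absurd n2 (c3 e1)
  | exact absurd n2 (c4 e2)
  | simp [e0, e1, e2, n1, n2, Finset.card_le_two, Finset.card_le_three]

/-- The weight of a control matching `M` is at most `2n + |V₃(M)|`. -/
theorem weightM_le {V : Type*} [Fintype V] [DecidableEq V] (G : SimpleGraph V)
    (nbr : V → Fin 3 → V) (hadj : ∀ u v : V, G.Adj u v ↔ ∃ i : Fin 3, nbr u i = v)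
    (hinj : ∀ u : V, Function.Injective (nbr u)) (M : Finset (Arc V))
    (hM : IsControlMatching G nbr M) :
    weightM G nbr M ≤ 2 * Fintype.card V + (V3 nbr M).card := by
  classical
  calc weightM G nbr M
      ≤ (Finset.univ.biUnion fun u => (assocArcs nbr u).filter (· ∈ M)).card := by
        refine Finset.card_le_card fun a ha => ?_
        rw [Finset.mem_filter] at ha
        exact Finset.mem_biUnion.2 ⟨a.1.1, Finset.mem_univ _,
          Finset.mem_filter.2 ⟨mem_assocArcs G nbr hadj ha.2, ha.1⟩⟩
    _ ≤ ∑ u : V, ((assocArcs nbr u).filter (· ∈ M)).card := Finset.card_biUnion_le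
    _ ≤ ∑ u : V, (2 + if u ∈ V3 nbr M then 1 else 0) :=
        Finset.sum_le_sum fun u _ => card_assocArcs_filter_le G nbr hinj M hM u
    _ = 2 * Fintype.card V + (V3 nbr M).card := by
        simp [Finset.sum_add_distrib, mul_comm]

/-- Without reverse pairs, `V₃(M)` is independent. -/
theorem V3_indep {V : Type*} [Fintype V] (G : SimpleGraph V)
    (nbr : V → Fin 3 → V) (hadj : ∀ u v : V, G.Adj u v ↔ ∃ i : Fin 3, nbr u i = v)
    (M : Finset (Arc V)) (hM : NoReversePair M) :
    ∀ a ∈ V3 nbr M, ∀ b ∈ V3 nbr M, ¬ G.Adj a b := by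
  intro a ha b hb hab
  simp only [V3, Finset.mem_filter, Finset.mem_univ, true_and] at ha hb
  obtain ⟨i, hi⟩ := (hadj a b).1 hab
  obtain ⟨j, hj⟩ := (hadj b a).1 hab.symm
  have h1 := ha i
  have h2 := hb j
  rw [hi] at h1
  rw [hj] at h2
  exact hM _ h1 h2

theorem bddAbove_indep_card {V : Type*} [Fintype V] (G : SimpleGraph V) :
    BddAbove {k : ℕ | ∃ S : Finset V, (∀ a ∈ S, ∀ b ∈ S, ¬ G.Adj a b) ∧ S.card = k} := by
  refine ⟨Fintype.card V, ?_⟩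
  rintro k ⟨S, -, rfl⟩
  exact Finset.card_le_univ S

/-- `OPT(H) = 2n + α(G)` for `H = f(G)` with `G` cubic on `n` vertices. -/
theorem stmt13 {V : Type*} [Fintype V] [DecidableEq V] (G : SimpleGraph V)
    (nbr : V → Fin 3 → V)
    (hadj : ∀ u v : V, G.Adj u v ↔ ∃ i : Fin 3, nbr u i = v)
    (hinj : ∀ u : V, Function.Injective (nbr u)) :
    OPT G nbr = 2 * Fintype.card V + indepNum G := by
  have hub : ∀ k ∈ {k : ℕ | ∃ M : Finset (Arc V),
      IsControlMatching G nbr M ∧ NoReversePair M ∧ weightM G nbr M = k},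
      k ≤ 2 * Fintype.card V + indepNum G := by
    rintro k ⟨M, hM, hR, rfl⟩
    refine (weightM_le G nbr hadj hinj M hM).trans (Nat.add_le_add_left ?_ _)
    exact le_csSup (bddAbove_indep_card G) ⟨V3 nbr M, V3_indep G nbr hadj M hR, rfl⟩
  apply le_antisymm
  · exact csSup_le' hub
  · obtain ⟨S, hS, hcard⟩ := Nat.sSup_mem (s := {k : ℕ | ∃ S : Finset V,
      (∀ a ∈ S, ∀ b ∈ S, ¬ G.Adj a b) ∧ S.card = k})
      ⟨0, ∅, by simp, rfl⟩ (bddAbove_indep_card G)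
    obtain ⟨M, hM, hR, hw⟩ := exists_controlMatching_of_indep G nbr hadj hinj S hS
    refine le_csSup ⟨_, hub⟩ ⟨M, hM, hR, ?_⟩
    rw [hw, hcard, indepNum]
end

section
/- Let G = (V, E) be a cubic simple graph with n = |V| and let H = f(G). Then OPT(H) ≤ 12 · α(G), where OPT(H) is the maximum weight of a control matching of H containing no pair of mutually reverse arcs and α(G) is the independence number of G. -/
/-- The weight of a control matching is at most the number `3 * |V|` of possible tails. -/
theorem weightM_le_three_mul_card {V : Type*} [Fintype V] (G : SimpleGraph V)
    (nbr : V → Fin 3 → V)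
    (hadj : ∀ u v : V, G.Adj u v ↔ ∃ i : Fin 3, nbr u i = v)
    (M : Finset (Arc V)) (hM : IsControlMatching G nbr M) :
    weightM G nbr M ≤ 3 * Fintype.card V := by
  classical
  have hsub : (M.filter (fun a => IsEdgeArc G a ∨ IsNodeArc nbr a)).image Prod.fst ⊆
      (Finset.univ : Finset (V × Fin 3)).image (fun p => (p.1, nbr p.1 p.2)) := by
    intro t ht
    obtain ⟨a, ha, rfl⟩ := Finset.mem_image.1 ht
    obtain ⟨-, h | ⟨u, rfl | rfl⟩⟩ := Finset.mem_filter.1 ha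
    · obtain ⟨i, hi⟩ := (hadj _ _).1 h.1
      exact Finset.mem_image.2 ⟨(a.1.1, i), Finset.mem_univ _, Prod.ext rfl hi⟩
    · exact Finset.mem_image.2 ⟨(u, 0), Finset.mem_univ _, rfl⟩
    · exact Finset.mem_image.2 ⟨(u, 1), Finset.mem_univ _, rfl⟩
  have hinjOn : Set.InjOn Prod.fst
      (M.filter (fun a => IsEdgeArc G a ∨ IsNodeArc nbr a) : Set (Arc V)) :=
    fun a ha b hb h => hM.2.1 a (Finset.mem_filter.1 ha).1 b (Finset.mem_filter.1 hb).1 h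
  calc weightM G nbr M
      = ((M.filter (fun a => IsEdgeArc G a ∨ IsNodeArc nbr a)).image Prod.fst).card := by
        rw [Finset.card_image_of_injOn hinjOn]
        unfold weightM
        congr
    _ ≤ _ := Finset.card_le_card hsub
    _ ≤ _ := Finset.card_image_le
    _ = 3 * Fintype.card V := by simp [mul_comm]

/-- The independence number bounds the size of every independent set. -/
theorem card_le_indepNum {V : Type*} [Fintype V] (G : SimpleGraph V) (S : Finset V)
    (hS : ∀ a ∈ S, ∀ b ∈ S, ¬ G.Adj a b) : S.card ≤ indepNum G := by
  refine le_csSup ⟨Fintype.card V, ?_⟩ ⟨S, hS, rfl⟩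
  rintro _ ⟨T, -, rfl⟩
  exact T.card_le_univ

/-- A maximal independent set dominates, so `|V| ≤ 4 * α(G)` when degrees are at most three. -/
theorem card_le_four_mul_indepNum {V : Type*} [Fintype V] (G : SimpleGraph V)
    (nbr : V → Fin 3 → V)
    (hadj : ∀ u v : V, G.Adj u v ↔ ∃ i : Fin 3, nbr u i = v) :
    Fintype.card V ≤ 4 * indepNum G := by
  classical
  obtain ⟨S, hS⟩ := Set.Finite.exists_maximal
    (Set.toFinite {S : Finset V | ∀ a ∈ S, ∀ b ∈ S, ¬ G.Adj a b}) ⟨∅, by simp⟩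
  have hind : ∀ a ∈ S, ∀ b ∈ S, ¬ G.Adj a b := hS.prop
  have hcover : (Finset.univ : Finset V) ⊆
      S.biUnion (fun a => insert a (Finset.univ.image (nbr a))) := by
    intro v _
    by_contra hv
    simp only [Finset.mem_biUnion, Finset.mem_insert, Finset.mem_image, Finset.mem_univ,
      true_and, ← hadj, not_exists, not_and, not_or] at hv
    have hvS : v ∉ S := fun h => (hv v h).1 rfl
    refine hvS (hS.le_of_ge (y := insert v S) ?_ (Finset.subset_insert v S)
      (Finset.mem_insert_self v S))
    intro a ha b hb hab
    rcases Finset.mem_insert.1 ha with h | h <;> rcases Finset.mem_insert.1 hb with h' | h'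
    · exact hab.ne (h.trans h'.symm)
    · exact (hv b h').2 (h ▸ hab.symm)
    · exact (hv a h).2 (h' ▸ hab)
    · exact hind a h b h' hab
  have hclosed : ∀ a ∈ S, (insert a (Finset.univ.image (nbr a))).card ≤ 4 := fun a _ =>
    (Finset.card_insert_le _ _).trans
      (Nat.succ_le_succ (Finset.card_image_le.trans (by simp)))
  have hcard := (Finset.card_le_card hcover).trans
    (Finset.card_biUnion_le_card_mul S _ 4 hclosed)
  have hle := card_le_indepNum G S hind
  rw [Finset.card_univ] at hcard
  omega

/-- `OPT(H) ≤ 12 · α(G)` for `H = f(G)` with `G` cubic. -/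
theorem stmt15 {V : Type*} [Fintype V] [DecidableEq V] (G : SimpleGraph V)
    (nbr : V → Fin 3 → V)
    (hadj : ∀ u v : V, G.Adj u v ↔ ∃ i : Fin 3, nbr u i = v)
    (hinj : ∀ u : V, Function.Injective (nbr u)) :
    OPT G nbr ≤ 12 * indepNum G := by
  refine csSup_le ⟨0, ∅, by simp [IsControlMatching, NoReversePair, weightM]⟩ ?_
  rintro _ ⟨M, hM, -, rfl⟩
  have hweight := weightM_le_three_mul_card G nbr hadj M hM
  have hcard := card_le_four_mul_indepNum G nbr hadj
  omega
end
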